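/- Let (x_n) be generated by Algorithm 1.1 for a nonempty closed convex set Z ⊆ H and x₀ ∈ L²(Ω,ℱ,P;H), with each x_n square-integrable. Suppose that for P-a.e. ω, every weak sequential cluster point of the sequence (x_n(ω))_{n∈ℕ} belongs to Z. Then, P-almost surely, x_n(ω) converges strongly (in norm) to proj_Z(x₀(ω)), and moreover E‖x_n − proj_Z x₀‖² → 0, i.e. x_n converges to proj_Z x₀ strongly in L²(Ω,ℱ,P;H). -/

import Mathlib

open MeasureTheory Filter RealInnerProductSpace Topology

/-- The half-space `H(x,y) = {z : ⟪z - y, x - y⟫ ≤ 0}`. -/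
def halfSpace {H : Type*} [NormedAddCommGroup H] [InnerProductSpace ℝ H] (x y : H) : Set H :=
  {z : H | ⟪z - y, x - y⟫ ≤ 0}

open scoped Classical in
/-- The outer set `O(x,y,z)`. -/
noncomputable def Oset {H : Type*} [NormedAddCommGroup H] [InnerProductSpace ℝ H]
    (x y z : H) : Set H :=
  if (halfSpace x y ∩ halfSpace y z).Nonempty then halfSpace x y ∩ halfSpace y z else {y}

/-- `q` is the metric projection of `x` onto `C`. -/
def IsProjPt {H : Type*} [NormedAddCommGroup H] [InnerProductSpace ℝ H]
    (C : Set H) (x q : H) : Prop :=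
  q ∈ C ∧ ∀ w ∈ C, ‖x - q‖ ≤ ‖x - w‖

/-- `w` is a weak sequential cluster point of the sequence `y`. -/
def WeakClusterPt {H : Type*} [NormedAddCommGroup H] [InnerProductSpace ℝ H]
    (y : ℕ → H) (w : H) : Prop :=
  ∃ φ : ℕ → ℕ, StrictMono φ ∧
    ∀ v : H, Tendsto (fun n => ⟪y (φ n), v⟫) atTop (𝓝 ⟪w, v⟫)

/-- A bounded sequence in a separable Hilbert space has a weak sequential cluster point. -/
theorem exists_weakClusterPt_of_norm_le {H : Type*} [NormedAddCommGroup H]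
    [InnerProductSpace ℝ H] [CompleteSpace H] [SecondCountableTopology H]
    {y : ℕ → H} {R : ℝ} (hy : ∀ n, ‖y n‖ ≤ R) : ∃ w, WeakClusterPt y w := by
  obtain ⟨f, -, φ, hφ, hlim⟩ := WeakDual.isSeqCompact_closedBall ℝ H 0 R
    (x := fun n => StrongDual.toWeakDual (InnerProductSpace.toDual ℝ H (y n)))
    (fun n => by simpa using hy n)
  refine ⟨(InnerProductSpace.toDual ℝ H).symm (WeakDual.toStrongDual f), φ, hφ, fun v => ?_⟩
  have h := ((WeakDual.eval_continuous v).tendsto f).comp hlim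
  simpa [Function.comp_def] using h

section InnerProduct

variable {H : Type*} [NormedAddCommGroup H] [InnerProductSpace ℝ H]

theorem WeakClusterPt.of_comp {y : ℕ → H} {ψ : ℕ → ℕ} (hψ : StrictMono ψ) {w : H}
    (h : WeakClusterPt (y ∘ ψ) w) : WeakClusterPt y w := by
  obtain ⟨φ, hφ, hlim⟩ := h
  exact ⟨ψ ∘ φ, hψ.comp hφ, hlim⟩

theorem convex_halfSpace (x y : H) : Convex ℝ (halfSpace x y) := by
  intro u hu v hv s t hs ht hst
  have hu' : ⟪u - y, x - y⟫ ≤ 0 := hu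
  have hv' : ⟪v - y, x - y⟫ ≤ 0 := hv
  have h : s • u + t • v - y = s • (u - y) + t • (v - y) := by
    rw [eq_sub_of_add_eq hst]; module
  change ⟪s • u + t • v - y, x - y⟫ ≤ 0
  rw [h, inner_add_left, real_inner_smul_left, real_inner_smul_left]
  nlinarith

/-- Relaxing the projection onto a half-space enlarges the half-space. -/
theorem halfSpace_subset_halfSpace_relaxed {x a : H} {l : ℝ} (hl : l ∈ Set.Ioc (0 : ℝ) 1) :
    halfSpace x a ⊆ halfSpace x (x + l • (a - x)) := by
  intro z hz
  have hz' : ⟪z - a, x - a⟫ ≤ 0 := hz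
  have h₁ : z - (x + l • (a - x)) = (z - a) - (1 - l) • (x - a) := by module
  have h₂ : x - (x + l • (a - x)) = l • (x - a) := by module
  change ⟪z - (x + l • (a - x)), x - (x + l • (a - x))⟫ ≤ 0
  rw [h₁, h₂, real_inner_smul_right, inner_sub_left, real_inner_smul_left]
  refine mul_nonpos_of_nonneg_of_nonpos hl.1.le ?_
  have := mul_nonneg (sub_nonneg.2 hl.2) (real_inner_self_nonneg (x := x - a))
  linarith

/-- A convex set lies in the half-space determined by a point and its projection. -/
theorem IsProjPt.subset_halfSpace {C : Set H} (hC : Convex ℝ C) {x q : H} (h : IsProjPt C x q) :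
    C ⊆ halfSpace x q := by
  intro w hw
  have : Nonempty C := ⟨⟨q, h.1⟩⟩
  have hmin : ‖x - q‖ = ⨅ w : C, ‖x - w‖ :=
    le_antisymm (le_ciInf fun w => h.2 w w.2)
      (ciInf_le ⟨0, fun _ ⟨_, h⟩ => h ▸ norm_nonneg _⟩ (⟨q, h.1⟩ : C))
  have := (norm_eq_iInf_iff_real_inner_le_zero hC h.1).1 hmin w hw
  rwa [real_inner_comm] at this

/-- If `p ∈ H(x, y)` then `‖y - p‖² ≤ ⟪y - p, x - p⟫`. -/
theorem norm_sub_sq_le_inner_of_mem_halfSpace {x y p : H} (h : p ∈ halfSpace x y) :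
    ‖y - p‖ ^ 2 ≤ ⟪y - p, x - p⟫ := by
  have h' : ⟪p - y, x - y⟫ ≤ 0 := h
  have h₁ : x - y = (x - p) - (y - p) := by abel
  rw [← neg_sub y p, h₁, inner_neg_left, inner_sub_right, real_inner_self_eq_norm_sq] at h'
  linarith

theorem norm_sub_le_of_mem_halfSpace {x y p : H} (h : p ∈ halfSpace x y) :
    ‖y - p‖ ≤ ‖x - p‖ := by
  have h₁ := (norm_sub_sq_le_inner_of_mem_halfSpace h).trans (real_inner_le_norm _ _)
  by_contra! hlt
  nlinarith [norm_nonneg (x - p)]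

/-- The iterates of Haugazeau's algorithm satisfy `Z ⊆ H(x₀, xₙ)`. -/
theorem subset_halfSpace_of_haugazeau {Z : Set H} (hZne : Z.Nonempty) {x r : ℕ → H}
    (hrZ : ∀ n, Z ⊆ halfSpace (x n) (r n))
    (hsucc : ∀ n, IsProjPt (Oset (x 0) (x n) (r n)) (x 0) (x (n + 1))) (n : ℕ) :
    Z ⊆ halfSpace (x 0) (x n) := by
  induction n with
  | zero => intro z _; simp [halfSpace]
  | succ n ih =>
    have hsub : Z ⊆ halfSpace (x 0) (x n) ∩ halfSpace (x n) (r n) :=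
      Set.subset_inter ih (hrZ n)
    have hproj := hsucc n
    rw [Oset, if_pos (hZne.mono hsub)] at hproj
    exact hsub.trans (hproj.subset_halfSpace ((convex_halfSpace _ _).inter (convex_halfSpace _ _)))

/-- If `Z ⊆ H(x₀, yₙ)` for all `n` and the weak sequential cluster points of `(yₙ)` lie in `Z`,
then `(yₙ)` converges strongly to the projection of `x₀` onto `Z`. -/
theorem tendsto_proj_of_subset_halfSpace [CompleteSpace H] [SecondCountableTopology H]
    {Z : Set H} (hZconv : Convex ℝ Z) {x₀ p : H} (hp : IsProjPt Z x₀ p) {y : ℕ → H}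
    (hy : ∀ n, Z ⊆ halfSpace x₀ (y n)) (hW : ∀ w, WeakClusterPt y w → w ∈ Z) :
    Tendsto y atTop (𝓝 p) := by
  have hbdd (n : ℕ) : ‖y n‖ ≤ ‖x₀ - p‖ + ‖p‖ := by
    have h₁ := norm_sub_le_of_mem_halfSpace (hy n hp.1)
    have h₂ := norm_add_le (y n - p) p
    rw [sub_add_cancel] at h₂
    linarith
  refine tendsto_of_subseq_tendsto fun ns hns => ?_
  obtain ⟨ψ, -, hψ⟩ := strictMono_subseq_of_tendsto_atTop hns
  obtain ⟨w, φ, hφ, hlim⟩ := exists_weakClusterPt_of_norm_le (y := y ∘ ns ∘ ψ) fun n => hbdd _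
  have hw : w ∈ Z := hW w (WeakClusterPt.of_comp hψ ⟨φ, hφ, hlim⟩)
  have hwp : ⟪w - p, x₀ - p⟫ ≤ 0 := hp.subset_halfSpace hZconv hw
  refine ⟨ψ ∘ φ, ?_⟩
  have hinner : Tendsto (fun n => ⟪y (ns (ψ (φ n))) - p, x₀ - p⟫) atTop
      (𝓝 ⟪w - p, x₀ - p⟫) := by
    simp only [inner_sub_left _ p]
    exact (hlim _).sub_const _
  have hle (n : ℕ) := norm_sub_sq_le_inner_of_mem_halfSpace (hy (ns (ψ (φ n))) hp.1)
  have hzero : ⟪w - p, x₀ - p⟫ = 0 :=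
    hwp.antisymm (ge_of_tendsto' hinner fun n => (sq_nonneg _).trans (hle n))
  rw [hzero] at hinner
  have hsq := (squeeze_zero (fun n => sq_nonneg _) hle hinner).sqrt
  rw [tendsto_iff_norm_sub_tendsto_zero]
  simpa using hsq

end InnerProduct

/-- Theorem 3.1(vii): if a.s. every weak sequential cluster point of `(xₙ)` lies in `Z`, then
`(xₙ)` converges strongly a.s. and strongly in `L²` to `proj_Z x₀`. -/
theorem haugazeau_strong_convergence
    {Ω : Type*} [MeasurableSpace Ω] (μ : Measure Ω)
    [IsProbabilityMeasure μ] [μ.IsComplete]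
    {H : Type*} [NormedAddCommGroup H] [InnerProductSpace ℝ H] [CompleteSpace H]
    [SecondCountableTopology H] [MeasurableSpace H] [BorelSpace H]
    (Z : Set H) (hZne : Z.Nonempty) (hZcl : IsClosed Z) (hZconv : Convex ℝ Z)
    (x a r : ℕ → Ω → H) (lam : ℕ → Ω → ℝ)
    (hx0 : MemLp (x 0) 2 μ)
    (hxL2 : ∀ n, MemLp (x n) 2 μ)
    (ha : ∀ n, MemLp (a n) 2 μ)
    (haZ : ∀ n, ∀ᵐ ω ∂μ, Z ⊆ halfSpace (x n ω) (a n ω))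
    (hlam_meas : ∀ n, Measurable (lam n))
    (hlam : ∀ n ω, lam n ω ∈ Set.Ioc (0 : ℝ) 1)
    (hr : ∀ n ω, r n ω = x n ω + lam n ω • (a n ω - x n ω))
    (hxsucc : ∀ n ω, IsProjPt (Oset (x 0 ω) (x n ω) (r n ω)) (x 0 ω) (x (n + 1) ω))
    (pZ : H → H) (hpZ : ∀ v : H, IsProjPt Z v (pZ v))
    (hW : ∀ᵐ ω ∂μ, ∀ w : H, WeakClusterPt (fun n => x n ω) w → w ∈ Z) :
    (∀ᵐ ω ∂μ, Tendsto (fun n => x n ω) atTop (𝓝 (pZ (x 0 ω)))) ∧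
    Tendsto (fun n => ∫ ω, ‖x n ω - pZ (x 0 ω)‖ ^ 2 ∂μ) atTop (𝓝 0) := by
  have hsub : ∀ᵐ ω ∂μ, ∀ n, Z ⊆ halfSpace (x 0 ω) (x n ω) := by
    filter_upwards [ae_all_iff.2 haZ] with ω hω n
    refine subset_halfSpace_of_haugazeau hZne (x := fun n => x n ω) (r := fun n => r n ω)
      (fun n => ?_) (fun n => hxsucc n ω) n
    rw [hr]
    exact (hω n).trans (halfSpace_subset_halfSpace_relaxed (hlam n ω))
  have hlim : ∀ᵐ ω ∂μ, Tendsto (fun n => x n ω) atTop (𝓝 (pZ (x 0 ω))) := by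
    filter_upwards [hsub, hW] with ω hω hWω
    exact tendsto_proj_of_subset_halfSpace hZconv (hpZ _) hω hWω
  refine ⟨hlim, ?_⟩
  have hmeas : AEStronglyMeasurable (fun ω => pZ (x 0 ω)) μ :=
    aestronglyMeasurable_of_tendsto_ae atTop (fun n => (hxL2 n).aestronglyMeasurable) hlim
  obtain ⟨z, hz⟩ := hZne
  have hint : Integrable (fun ω => ‖x 0 ω - z‖ ^ 2) μ :=
    (hx0.sub (memLp_const z)).integrable_norm_pow two_ne_zero
  have h := tendsto_integral_of_dominated_convergence (f := fun _ => (0 : ℝ)) _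
    (F := fun n ω => ‖x n ω - pZ (x 0 ω)‖ ^ 2)
    (fun n => ((hxL2 n).aestronglyMeasurable.sub hmeas).norm.pow 2) hint
    (fun n => by
      filter_upwards [hsub] with ω hω
      rw [norm_pow, norm_norm]
      gcongr
      exact (norm_sub_le_of_mem_halfSpace (hω n (hpZ _).1)).trans ((hpZ _).2 z hz))
    (by
      filter_upwards [hlim] with ω hω
      simpa using (tendsto_iff_norm_sub_tendsto_zero.1 hω).pow 2)
  simpa using h
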